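/- Let n ≥ 1 and let Ω be a nonempty open convex subset of ℝⁿ with Ω ≠ ℝⁿ whose limit set Λ_{Aut⁰(Ω)} is nonempty. Then there is no subgroup Γ of Aut(Ω) such that (a) Γ acts freely and properly discontinuously on Ω, (b) the action is cocompact, i.e., there is a compact set K ⊆ Ω with ⋃_{γ∈Γ} γ(K) = Ω, and (c) the linear part of every element of Γ has determinant 1. (Equivalently: a compact convex affine manifold whose developing image Ω is a proper subset of ℝⁿ cannot have parallel volume if Λ_{Aut⁰(Ω)} is nonempty.) -/

import Mathlib

open Matrix Set Filter Topology Pointwise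

noncomputable section

/-- The affine action on ℝⁿ of an (n+1)×(n+1) invertible matrix in affine form
(ℝⁿ is identified with the hyperplane x_{n+1} = 1). -/
def affAct (n : ℕ) (g : GL (Fin (n + 1)) ℝ) (x : Fin n → ℝ) : Fin n → ℝ :=
  fun i => (∑ j : Fin n, g.val i.castSucc j.castSucc * x j) + g.val i.castSucc (Fin.last n)

/-- A matrix in GL(n+1,ℝ) has affine form if its last row is (0, …, 0, 1). -/
def IsAffineForm (n : ℕ) (g : GL (Fin (n + 1)) ℝ) : Prop :=
  (∀ j : Fin n, g.val (Fin.last n) j.castSucc = 0) ∧ g.val (Fin.last n) (Fin.last n) = 1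

/-- Aut(Ω): the group (here: set) of affine transformations of ℝⁿ preserving Ω,
realized as affine-form matrices in GL(n+1,ℝ). -/
def AutSet (n : ℕ) (Ω : Set (Fin n → ℝ)) : Set (GL (Fin (n + 1)) ℝ) :=
  {g | IsAffineForm n g ∧ affAct n g '' Ω = Ω}

/-- Aut⁰(Ω): the identity component of Aut(Ω). -/
def AutIdComp (n : ℕ) (Ω : Set (Fin n → ℝ)) : Set (GL (Fin (n + 1)) ℝ) :=
  connectedComponentIn (AutSet n Ω) 1

/-- The limit set Λ_G of a subset G of Aut(Ω). -/
def limitSet (n : ℕ) (Ω : Set (Fin n → ℝ)) (G : Set (GL (Fin (n + 1)) ℝ)) :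
    Set (Fin n → ℝ) :=
  {ξ | ξ ∈ frontier Ω ∧ ∃ x ∈ Ω, ∃ u : ℕ → GL (Fin (n + 1)) ℝ,
    (∀ k, u k ∈ G) ∧ Filter.Tendsto (fun k => affAct n (u k) x) Filter.atTop (nhds ξ)}

/-- Ω is a convex affine domain: a nonempty open convex subset of ℝⁿ. -/
def IsConvexDomain (n : ℕ) (Ω : Set (Fin n → ℝ)) : Prop :=
  Ω.Nonempty ∧ IsOpen Ω ∧ Convex ℝ Ω

/-- Ω contains no complete affine line. -/
def HasNoLine (n : ℕ) (Ω : Set (Fin n → ℝ)) : Prop :=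
  ¬ ∃ x ∈ Ω, ∃ v : Fin n → ℝ, v ≠ 0 ∧ ∀ t : ℝ, x + t • v ∈ Ω

/-- Ω is a properly convex affine domain. -/
def IsProperlyConvexDomain (n : ℕ) (Ω : Set (Fin n → ℝ)) : Prop :=
  IsConvexDomain n Ω ∧ HasNoLine n Ω

/-- Ω is quasi-homogeneous: some compact K ⊆ Ω has ⋃_{g ∈ Aut(Ω)} g(K) = Ω. -/
def IsQuasiHomogeneous (n : ℕ) (Ω : Set (Fin n → ℝ)) : Prop :=
  ∃ K : Set (Fin n → ℝ), IsCompact K ∧ K ⊆ Ω ∧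
    (⋃ g ∈ AutSet n Ω, affAct n g '' K) = Ω

/-- Aut(Ω) is irreducible: it preserves no nonempty proper affine subspace of ℝⁿ. -/
def IsIrreducibleAut (n : ℕ) (Ω : Set (Fin n → ℝ)) : Prop :=
  ¬ ∃ S : AffineSubspace ℝ (Fin n → ℝ), (S : Set (Fin n → ℝ)).Nonempty ∧
      (S : Set (Fin n → ℝ)) ≠ Set.univ ∧
      ∀ g ∈ AutSet n Ω, affAct n g '' (S : Set (Fin n → ℝ)) = (S : Set (Fin n → ℝ))

/-- The asymptotic cone AC(Ω). -/
def asympCone (n : ℕ) (Ω : Set (Fin n → ℝ)) : Set (Fin n → ℝ) :=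
  {u | ∀ x ∈ Ω, ∀ t : ℝ, 0 ≤ t → x + t • u ∈ Ω}

/-- Ω is a cone with some vertex v. -/
def IsCone (n : ℕ) (Ω : Set (Fin n → ℝ)) : Prop :=
  ∃ v : Fin n → ℝ, ∀ x ∈ Ω, ∀ t : ℝ, 0 < t → v + t • (x - v) ∈ Ω

/-- Two subsets of ℝⁿ are affinely equivalent. -/
def AffinelyEquivalent (n : ℕ) (Ω Ω' : Set (Fin n → ℝ)) : Prop :=
  ∃ e : (Fin n → ℝ) ≃ᵃ[ℝ] (Fin n → ℝ), e '' Ω = Ω'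

/-- Γ acts freely on Ω. -/
def ActsFreely (n : ℕ) (Ω : Set (Fin n → ℝ)) (Γ : Set (GL (Fin (n + 1)) ℝ)) : Prop :=
  ∀ γ ∈ Γ, γ ≠ 1 → ∀ x ∈ Ω, affAct n γ x ≠ x

/-- Γ acts properly discontinuously on Ω. -/
def ActsProperlyDiscontinuously (n : ℕ) (Ω : Set (Fin n → ℝ))
    (Γ : Set (GL (Fin (n + 1)) ℝ)) : Prop :=
  ∀ K L : Set (Fin n → ℝ), K ⊆ Ω → L ⊆ Ω → IsCompact K → IsCompact L →
    {γ ∈ Γ | (affAct n γ '' K ∩ L).Nonempty}.Finite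

/-- Γ acts cocompactly on Ω. -/
def ActsCocompactly (n : ℕ) (Ω : Set (Fin n → ℝ)) (Γ : Set (GL (Fin (n + 1)) ℝ)) : Prop :=
  ∃ K : Set (Fin n → ℝ), IsCompact K ∧ K ⊆ Ω ∧ (⋃ γ ∈ Γ, affAct n γ '' K) = Ω

/-- The linear part of an affine-form matrix has determinant one. -/
def LinearPartDetOne (n : ℕ) (g : GL (Fin (n + 1)) ℝ) : Prop :=
  (Matrix.of fun i j : Fin n => g.val i.castSucc j.castSucc).det = 1

/-- A group `Γ` acts on `E` by affine maps with linear parts `lin γ`; the action preserves `Ω`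
and is properly discontinuous there. -/
structure IsProperAffineAction {E Γ : Type*} [NormedAddCommGroup E] [NormedSpace ℝ E] [Group Γ]
    [MulAction Γ E] (lin : Γ → E →ₗ[ℝ] E) (Ω : Set E) : Prop where
  smul_add : ∀ (γ : Γ) (x v : E), γ • (x + v) = γ • x + lin γ v
  smul_mem : ∀ γ : Γ, ∀ x ∈ Ω, γ • x ∈ Ω
  finite : ∀ K L : Set E, K ⊆ Ω → L ⊆ Ω → IsCompact K → IsCompact L →
    {γ : Γ | ∃ x ∈ K, γ • x ∈ L}.Finite

namespace IsProperAffineAction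

section Basic

open scoped ENNReal

variable {E Γ : Type*} [NormedAddCommGroup E] [NormedSpace ℝ E] [Group Γ] [MulAction Γ E]
  {lin : Γ → E →ₗ[ℝ] E} {Ω : Set E}

theorem lin_mul (h : IsProperAffineAction lin Ω) (γ η : Γ) (v : E) :
    lin (γ * η) v = lin γ (lin η v) := by
  have h1 := h.smul_add (γ * η) 0 v
  rw [mul_smul, h.smul_add η 0 v, h.smul_add γ, mul_smul] at h1
  exact (add_left_cancel h1).symm

theorem lin_one (h : IsProperAffineAction lin Ω) (v : E) : lin 1 v = v := by
  have h1 := h.smul_add 1 0 v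
  simpa using h1.symm

theorem lin_inv_apply (h : IsProperAffineAction lin Ω) (γ : Γ) (v : E) :
    lin γ⁻¹ (lin γ v) = v := by
  rw [← h.lin_mul, inv_mul_cancel, h.lin_one]

theorem smul_mem_iff (h : IsProperAffineAction lin Ω) (γ : Γ) (x : E) : γ • x ∈ Ω ↔ x ∈ Ω :=
  ⟨fun hx => by simpa using h.smul_mem γ⁻¹ _ hx, h.smul_mem γ x⟩

theorem smul_eq (h : IsProperAffineAction lin Ω) (γ : Γ) (x : E) : γ • x = γ • 0 + lin γ x := by
  simpa using h.smul_add γ 0 x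

theorem continuous_smul [FiniteDimensional ℝ E] (h : IsProperAffineAction lin Ω) (γ : Γ) :
    Continuous fun x : E => γ • x := by
  rw [show (fun x : E => γ • x) = fun x => γ • 0 + lin γ x from funext (h.smul_eq γ)]
  exact continuous_const.add (lin γ).continuous_of_finiteDimensional

theorem finite_inv_smul_mem (h : IsProperAffineAction lin Ω) {K : Set E} (hK : IsCompact K)
    (hKΩ : K ⊆ Ω) {x : E} (hx : x ∈ Ω) : {γ : Γ | γ⁻¹ • x ∈ K}.Finite := by
  refine ((h.finite K {x} hKΩ (by simpa using hx) hK isCompact_singleton)).subset ?_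
  intro γ hγ
  exact ⟨γ⁻¹ • x, hγ, by simp⟩

theorem countable [FiniteDimensional ℝ E] (h : IsProperAffineAction lin Ω) (hΩ : IsOpen Ω)
    (hne : Ω.Nonempty) : Countable Γ := by
  have : LocallyCompactSpace Ω := hΩ.locallyCompactSpace
  obtain ⟨x, hx⟩ := hne
  have : (univ : Set Γ) ⊆ ⋃ k : ℕ,
      {γ : Γ | ∃ y ∈ ({x} : Set E), γ • y ∈ ((↑) : Ω → E) '' compactCovering Ω k} := by
    intro γ _
    obtain ⟨k, hk⟩ := exists_mem_compactCovering (⟨γ • x, h.smul_mem γ x hx⟩ : Ω)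
    exact mem_iUnion.2 ⟨k, x, rfl, _, hk, rfl⟩
  rw [← countable_univ_iff]
  refine (countable_iUnion fun k => Set.Finite.countable ?_).mono this
  exact h.finite _ _ (by simpa using hx) (by rintro _ ⟨y, -, rfl⟩; exact y.2)
    isCompact_singleton ((isCompact_compactCovering Ω k).image continuous_subtype_val)

/-- The number of translates of `A` that contain `x`. -/
def orbitCount (Γ : Type*) {E : Type*} [Group Γ] [MulAction Γ E] (A : Set E) (x : E) : ℝ≥0∞ :=
  ∑' γ : Γ, A.indicator 1 (γ⁻¹ • x)

theorem orbitCount_smul {E Γ : Type*} [Group Γ] [MulAction Γ E] (A : Set E) (γ : Γ) (x : E) :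
    orbitCount Γ A (γ • x) = orbitCount Γ A x := by
  unfold orbitCount
  rw [← (Equiv.mulLeft γ).tsum_eq]
  simp [mul_smul]

theorem orbitCount_ne_zero {E Γ : Type*} [Group Γ] [MulAction Γ E] {A : Set E} {γ : Γ} {x : E}
    (hx : γ⁻¹ • x ∈ A) : orbitCount Γ A x ≠ 0 := by
  unfold orbitCount
  rw [Ne, ENNReal.tsum_eq_zero]
  intro h0
  simpa [hx] using h0 γ

theorem orbitCount_ne_top (h : IsProperAffineAction lin Ω) {A K : Set E} (hAK : A ⊆ K)
    (hK : IsCompact K) (hKΩ : K ⊆ Ω) {x : E} (hx : x ∈ Ω) : orbitCount Γ A x ≠ ∞ := by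
  have hfin := h.finite_inv_smul_mem hK hKΩ hx
  unfold orbitCount
  rw [tsum_eq_sum (s := hfin.toFinset)]
  · refine ENNReal.sum_ne_top.2 fun γ _ => ?_
    by_cases hγ : γ⁻¹ • x ∈ A <;> simp [hγ]
  · intro γ hγ
    have : γ⁻¹ • x ∉ A := fun hA => hγ (by simpa using hAK hA)
    simp [this]

end Basic

section Measure

open MeasureTheory
open scoped ENNReal

variable {E Γ : Type*} [NormedAddCommGroup E] [NormedSpace ℝ E] [FiniteDimensional ℝ E]
  [MeasurableSpace E] [BorelSpace E] [Group Γ] [MulAction Γ E]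
  {lin : Γ → E →ₗ[ℝ] E} {Ω : Set E}

theorem measurePreserving_smul (h : IsProperAffineAction lin Ω)
    (hdet : ∀ γ, LinearMap.det (lin γ) = 1) (μ : Measure E) [μ.IsAddHaarMeasure] (γ : Γ) :
    MeasurePreserving (fun x : E => γ • x) μ μ := by
  have h1 : MeasurePreserving (lin γ) μ μ := by
    refine ⟨(lin γ).continuous_of_finiteDimensional.measurable, ?_⟩
    rw [Measure.map_linearMap_addHaar_eq_smul_addHaar μ (by simp [hdet])]
    simp [hdet]
  have h2 := (measurePreserving_add_left μ (γ • (0 : E))).comp h1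
  convert h2 using 1
  ext x
  exact h.smul_eq γ x

theorem measurable_orbitCount [Countable Γ] (h : IsProperAffineAction lin Ω) {A : Set E}
    (hA : MeasurableSet A) : Measurable (orbitCount Γ A) := by
  unfold orbitCount
  refine Measurable.tsum fun γ => ?_
  exact (measurable_one.indicator hA).comp (h.continuous_smul γ⁻¹).measurable

theorem setLIntegral_orbitCount_mul [Countable Γ] (h : IsProperAffineAction lin Ω)
    (hdet : ∀ γ, LinearMap.det (lin γ) = 1) (μ : Measure E) [μ.IsAddHaarMeasure] {A B : Set E}
    (hA : MeasurableSet A) (hB : MeasurableSet B) {f : E → ℝ≥0∞} (hf : Measurable f)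
    (hinv : ∀ (γ : Γ) x, f (γ • x) = f x) :
    ∫⁻ x in A, orbitCount Γ B x * f x ∂μ = ∫⁻ x in B, orbitCount Γ A x * f x ∂μ := by
  have key : ∀ {A B : Set E}, MeasurableSet A → MeasurableSet B →
      ∫⁻ x in A, orbitCount Γ B x * f x ∂μ =
        ∑' γ : Γ, ∫⁻ x, A.indicator 1 x * (B.indicator 1 (γ⁻¹ • x) * f x) ∂μ := by
    intro A B hA hB
    rw [← lintegral_indicator hA, ← lintegral_tsum]
    · refine lintegral_congr fun x => ?_
      by_cases hx : x ∈ A <;> simp [hx, orbitCount, ENNReal.tsum_mul_right]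
    · intro γ
      have h1 := (measurable_one.indicator hB : Measurable (B.indicator (1 : E → ℝ≥0∞))).comp
        (h.continuous_smul γ⁻¹).measurable
      exact ((measurable_one.indicator hA).mul (h1.mul hf)).aemeasurable
  rw [key hA hB, key hB hA, ← (Equiv.inv Γ).tsum_eq]
  refine tsum_congr fun γ => ?_
  have h1 := (measurable_one.indicator hA : Measurable (A.indicator (1 : E → ℝ≥0∞)))
  have h2 := (measurable_one.indicator hB : Measurable (B.indicator (1 : E → ℝ≥0∞)))
  have h3 := h2.comp (h.continuous_smul γ).measurable
  rw [← (h.measurePreserving_smul hdet μ γ⁻¹).lintegral_comp]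
  · refine lintegral_congr fun x => ?_
    simp [hinv]
    ring
  · simp only [Equiv.inv_apply, inv_inv]
    exact h1.mul (h3.mul hf)

/-- Two sets whose translates cover `Ω` have the same mass, each point being weighted by the
inverse of the number of translates containing it. -/
theorem setLIntegral_inv_orbitCount [Countable Γ] (h : IsProperAffineAction lin Ω)
    (hdet : ∀ γ, LinearMap.det (lin γ) = 1) (μ : Measure E) [μ.IsAddHaarMeasure] {A B : Set E}
    (hA : IsCompact A) (hB : IsCompact B) (hAΩ : A ⊆ Ω) (hBΩ : B ⊆ Ω)
    (hcA : ∀ x ∈ Ω, ∃ γ : Γ, γ⁻¹ • x ∈ A) (hcB : ∀ x ∈ Ω, ∃ γ : Γ, γ⁻¹ • x ∈ B) :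
    ∫⁻ x in A, (orbitCount Γ A x)⁻¹ ∂μ = ∫⁻ x in B, (orbitCount Γ B x)⁻¹ ∂μ := by
  have key : ∀ {A B : Set E}, IsCompact A → IsCompact B → A ⊆ Ω → B ⊆ Ω →
      (∀ x ∈ Ω, ∃ γ : Γ, γ⁻¹ • x ∈ B) → ∫⁻ x in A, (orbitCount Γ A x)⁻¹ ∂μ =
        ∫⁻ x in A, orbitCount Γ B x * ((orbitCount Γ A x)⁻¹ * (orbitCount Γ B x)⁻¹) ∂μ := by
    intro A B hA hB hAΩ hBΩ hcB
    refine setLIntegral_congr_fun hA.measurableSet fun x hx => ?_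
    obtain ⟨γ, hγ⟩ := hcB x (hAΩ hx)
    rw [mul_comm, mul_assoc, ENNReal.inv_mul_cancel (orbitCount_ne_zero hγ)
      (h.orbitCount_ne_top subset_rfl hB hBΩ (hAΩ hx)), mul_one]
  rw [key hA hB hAΩ hBΩ hcB, key hB hA hBΩ hAΩ hcA,
    h.setLIntegral_orbitCount_mul hdet μ hA.measurableSet hB.measurableSet]
  · simp_rw [mul_comm (orbitCount Γ A _)⁻¹]
  · exact (h.measurable_orbitCount hA.measurableSet).inv.mul
      (h.measurable_orbitCount hB.measurableSet).inv
  · intro γ x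
    simp_rw [orbitCount_smul]

end Measure

end IsProperAffineAction

theorem exists_sum_det_eq {E : Type*} [NormedAddCommGroup E] [NormedSpace ℝ E]
    [FiniteDimensional ℝ E] {ε : ℝ} (hε : 0 < ε) :
    ∃ (m : ℕ) (c t : Fin m → ℝ), (∀ i, t i ∈ Ioo 0 ε) ∧ ∑ i, c i = 1 ∧
      ∀ A : E →L[ℝ] E, (1 + A).det = ∑ i, c i * (1 + t i • A).det := by
  set d := Module.finrank ℝ E
  set b := Module.finBasis ℝ E
  let t : Fin (d + 1) → ℝ := fun i => ε * ((i + 1) / (d + 2))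
  have hinj : InjOn t (Finset.univ : Finset (Fin (d + 1))) := by
    intro i _ j _ hij
    have h2 : (0 : ℝ) < d + 2 := by positivity
    have h3 := mul_left_cancel₀ hε.ne' hij
    rw [div_left_inj' h2.ne'] at h3
    exact Fin.ext (by exact_mod_cast add_right_cancel h3)
  refine ⟨d + 1, fun i => (Lagrange.basis Finset.univ t i).eval 1, t, fun i => ?_, ?_, fun A => ?_⟩
  · have hi : (i : ℝ) + 1 < d + 2 := by
      have := i.2
      exact_mod_cast (by omega : (i : ℕ) + 1 < d + 2)
    have h2 : (0 : ℝ) < d + 2 := by positivity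
    exact ⟨by positivity, mul_lt_of_lt_one_right hε ((div_lt_one h2).2 hi)⟩
  · rw [← Polynomial.eval_finsetSum, Lagrange.sum_basis hinj Finset.univ_nonempty,
      Polynomial.eval_one]
  · set M := LinearMap.toMatrix b b (A : E →ₗ[ℝ] E)
    let p : Polynomial ℝ :=
      ((Polynomial.X : Polynomial ℝ) • M.map Polynomial.C + (1 : Matrix _ _ ℝ).map Polynomial.C).det
    have hp : ∀ s : ℝ, (1 + s • A).det = p.eval s := by
      intro s
      have h1 : (1 + s • A).det = LinearMap.det ((1 : E →ₗ[ℝ] E) + s • (A : E →ₗ[ℝ] E)) := rfl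
      rw [h1, ← LinearMap.det_toMatrix b, map_add, map_smul, LinearMap.toMatrix_one]
      rw [← Polynomial.coe_evalRingHom, RingHom.map_det]
      congr 1
      ext i j
      have h2 : ((1 : Matrix (Fin d) (Fin d) ℝ) i j : ℝ) =
          Polynomial.eval s ((1 : Matrix (Fin d) (Fin d) (Polynomial ℝ)) i j) := by
        rw [Matrix.one_apply, Matrix.one_apply]
        split_ifs <;> simp
      simp only [Matrix.add_apply, Matrix.smul_apply, smul_eq_mul, RingHom.mapMatrix_apply,
        Matrix.map_apply, Polynomial.coe_evalRingHom, Polynomial.eval_add, Polynomial.eval_mul,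
        Polynomial.eval_X, Polynomial.eval_C, M]
      ring
    have hdeg : p.degree < (Finset.univ : Finset (Fin (d + 1))).card := by
      refine lt_of_le_of_lt (Polynomial.degree_le_of_natDegree_le
        (Polynomial.natDegree_det_X_add_C_le M 1)) ?_
      rw [Fintype.card_fin, Finset.card_univ, Fintype.card_fin]
      exact_mod_cast Nat.lt_succ_self d
    have h1 := congrArg (Polynomial.eval 1) (Lagrange.eq_interpolate hinj hdeg)
    rw [Lagrange.interpolate_apply, Polynomial.eval_finsetSum] at h1
    have h2 := hp 1
    rw [one_smul] at h2
    rw [h2, h1]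
    refine Finset.sum_congr rfl fun i _ => ?_
    rw [hp, Polynomial.eval_mul, Polynomial.eval_C, mul_comm]

namespace IsProperAffineAction

section Perturbation

variable {E Γ : Type*} [NormedAddCommGroup E] [NormedSpace ℝ E]
  [Group Γ] [MulAction Γ E] {lin : Γ → E →ₗ[ℝ] E} {Ω : Set E}

theorem orbitCount_image {G : E → E} (hG : InjOn G Ω) {K : Set E} (hKΩ : K ⊆ Ω)
    (h : IsProperAffineAction lin Ω) (hequi : ∀ γ : Γ, ∀ x ∈ Ω, γ • G x = G (γ • x)) {x : E}
    (hx : x ∈ Ω) : orbitCount Γ (G '' K) (G x) = orbitCount Γ K x := by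
  unfold orbitCount
  refine tsum_congr fun γ => ?_
  rw [hequi _ _ hx]
  by_cases hγ : γ⁻¹ • x ∈ K
  · simp [hγ, mem_image_of_mem G hγ]
  · have : G (γ⁻¹ • x) ∉ G '' K := by
      rwa [hG.mem_image_iff hKΩ (h.smul_mem _ _ hx)]
    simp [hγ, this]

theorem smul_add_smul (h : IsProperAffineAction lin Ω) {w : E → E}
    (hequi : ∀ γ : Γ, ∀ x ∈ Ω, w (γ • x) = lin γ (w x)) (γ : Γ) {x : E} (hx : x ∈ Ω) (t : ℝ) :
    γ • (x + t • w x) = γ • x + t • w (γ • x) := by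
  rw [h.smul_add, hequi γ x hx, map_smul]

/-- A small equivariant locally Lipschitz perturbation of the identity is a bijection of `Ω`. -/
theorem exists_bijOn_add_smul [FiniteDimensional ℝ E] (h : IsProperAffineAction lin Ω)
    (hΩ : IsOpen Ω) {K : Set E}
    (hK : IsCompact K) (hKΩ : K ⊆ Ω) (hcov : ∀ x ∈ Ω, ∃ γ : Γ, γ⁻¹ • x ∈ K) {w : E → E}
    (hw : LocallyLipschitzOn Ω w) (hequi : ∀ γ : Γ, ∀ x ∈ Ω, w (γ • x) = lin γ (w x)) :
    ∃ ε > 0, ∀ t ∈ Ioo (0 : ℝ) ε, BijOn (fun x => x + t • w x) Ω Ω := by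
  obtain ⟨δ, hδ, hδΩ⟩ := hK.exists_cthickening_subset_open hΩ hKΩ
  set K' := Metric.cthickening δ K
  have hK' : IsCompact K' := hK.cthickening
  have hS := h.finite K' K' hδΩ hδΩ hK' hK'
  set S := {γ : Γ | ∃ x ∈ K', γ • x ∈ K'}
  set K2 : Set E := K' ∪ ⋃ γ ∈ S, (fun x : E => γ • x) '' K
  have hK2 : IsCompact K2 :=
    hK'.union (hS.isCompact_biUnion fun γ _ => hK.image (h.continuous_smul γ))
  have hK2Ω : K2 ⊆ Ω := by
    refine union_subset hδΩ (iUnion₂_subset fun γ _ => ?_)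
    rintro _ ⟨x, hx, rfl⟩
    exact h.smul_mem γ x (hKΩ hx)
  obtain ⟨Λ, hΛ⟩ := (hw.mono hK2Ω).exists_lipschitzOnWith_of_compact hK2
  obtain ⟨B, hB⟩ := hK2.exists_bound_of_continuousOn (hw.continuousOn.mono hK2Ω)
  have hsmall : ∀ s : ℝ, 0 ≤ s → ∃ ε > 0, ∀ t ∈ Ioo (0 : ℝ) ε, t * s < 1 := by
    intro s hs
    refine ⟨1 / (s + 1), by positivity, fun t ht => ?_⟩
    have := (lt_div_iff₀ (by positivity)).1 ht.2
    nlinarith [ht.1]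
  obtain ⟨ε₁, hε₁, h1⟩ := hsmall Λ Λ.2
  obtain ⟨ε₂, hε₂, h2⟩ := hsmall (|B| / δ) (by positivity)
  refine ⟨min ε₁ ε₂, lt_min hε₁ hε₂, fun t ht => ?_⟩
  have ht0 : 0 < t := ht.1
  have htΛ := h1 t ⟨ht0, ht.2.trans_le (min_le_left _ _)⟩
  have htB : t * |B| < δ := by
    have := h2 t ⟨ht0, ht.2.trans_le (min_le_right _ _)⟩
    rwa [← mul_div_assoc, div_lt_one hδ] at this
  have htw : ∀ x ∈ K2, ‖t • w x‖ ≤ δ := by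
    intro x hx
    rw [norm_smul, Real.norm_of_nonneg ht0.le]
    exact (mul_le_mul_of_nonneg_left ((hB x hx).trans (le_abs_self B)) ht0.le).trans htB.le
  have hKK' : K ⊆ K' := Metric.self_subset_cthickening K
  have hK'2 : K' ⊆ K2 := subset_union_left
  have hmapsK : ∀ x ∈ K, x + t • w x ∈ K' := fun x hx =>
    Metric.mem_cthickening_of_dist_le _ x δ K hx (by simpa using htw x (hK'2 (hKK' hx)))
  have hequiG := fun γ x hx => h.smul_add_smul hequi γ (x := x) hx t
  refine ⟨fun x hx => ?_, fun x hx y hy hxy => ?_, fun y hy => ?_⟩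
  · obtain ⟨γ, hγ⟩ := hcov x hx
    have := hδΩ (hmapsK _ hγ)
    rwa [← hequiG _ _ hx, h.smul_mem_iff] at this
  · obtain ⟨γ, hγ⟩ := hcov x hx
    obtain ⟨η, hη⟩ := hcov (γ⁻¹ • y) (h.smul_mem _ _ hy)
    have hx' := h.smul_mem γ⁻¹ x hx
    have hy' := h.smul_mem γ⁻¹ y hy
    have hxy' : γ⁻¹ • x + t • w (γ⁻¹ • x) = γ⁻¹ • y + t • w (γ⁻¹ • y) := by
      rw [← hequiG _ _ hx, ← hequiG _ _ hy]
      exact congrArg _ hxy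
    have hηS : η ∈ S := by
      refine ⟨_, hmapsK _ hη, ?_⟩
      rw [← hequiG _ _ hy', smul_inv_smul, ← hxy']
      exact hmapsK _ hγ
    have hxK : γ⁻¹ • x ∈ K2 := hK'2 (hKK' hγ)
    have hyK : γ⁻¹ • y ∈ K2 :=
      Or.inr (mem_iUnion₂.2 ⟨η, hηS, η⁻¹ • γ⁻¹ • y, hη, smul_inv_smul _ _⟩)
    have h3 : γ⁻¹ • x - γ⁻¹ • y = t • (w (γ⁻¹ • y) - w (γ⁻¹ • x)) := by
      rw [smul_sub, sub_eq_sub_iff_add_eq_add, hxy', add_comm]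
    have h4 := hΛ.dist_le_mul _ hyK _ hxK
    have h5 : dist (γ⁻¹ • y) (γ⁻¹ • x) ≤ t * (Λ * dist (γ⁻¹ • y) (γ⁻¹ • x)) := by
      refine le_trans (le_of_eq ?_) (mul_le_mul_of_nonneg_left h4 ht0.le)
      rw [dist_comm, dist_eq_norm, h3, norm_smul, Real.norm_of_nonneg ht0.le, dist_eq_norm]
    have h6 : dist (γ⁻¹ • y) (γ⁻¹ • x) = 0 := by
      have := dist_nonneg (x := γ⁻¹ • y) (y := γ⁻¹ • x)
      nlinarith
    exact (smul_left_cancel _ (dist_eq_zero.1 h6)).symm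
  · obtain ⟨γ, hγ⟩ := hcov y hy
    set z := γ⁻¹ • y
    have hball : Metric.closedBall z δ ⊆ K' := Metric.closedBall_subset_cthickening hγ δ
    have hmaps : MapsTo (fun x => z - t • w x) (Metric.closedBall z δ) (Metric.closedBall z δ) := by
      intro x hx
      simpa [dist_eq_norm] using htw x (hK'2 (hball hx))
    have hcontr : ContractingWith (⟨t, ht0.le⟩ * Λ) (hmaps.restrict _ _ _) := by
      refine ⟨by exact_mod_cast htΛ, LipschitzWith.of_dist_le_mul fun a b => ?_⟩
      have h4 := hΛ.dist_le_mul _ (hK'2 (hball b.2)) _ (hK'2 (hball a.2))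
      change dist (z - t • w a) (z - t • w b) ≤ t * Λ * dist (a : E) b
      rw [dist_eq_norm, sub_sub_sub_cancel_left, ← smul_sub, norm_smul,
        Real.norm_of_nonneg ht0.le, ← dist_eq_norm, mul_assoc, dist_comm (a : E)]
      exact mul_le_mul_of_nonneg_left h4 ht0.le
    obtain ⟨x, hxb, hx, -⟩ := hcontr.exists_fixedPoint' Metric.isClosed_closedBall.isComplete hmaps
      (Metric.mem_closedBall_self hδ.le) (edist_ne_top _ _)
    have hxΩ := hδΩ (hball hxb)
    have hx' : x + t • w x = z := by
      have : z - t • w x = x := hx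
      rw [← this]; nth_rewrite 2 [this]; abel
    refine ⟨γ • x, h.smul_mem γ x hxΩ, ?_⟩
    change γ • x + t • w (γ • x) = y
    rw [← hequiG _ _ hxΩ, hx', smul_inv_smul]

end Perturbation

end IsProperAffineAction

theorem LipschitzOnWith.addHaar_image_eq_zero {E : Type*} [NormedAddCommGroup E]
    [NormedSpace ℝ E] [FiniteDimensional ℝ E] [MeasurableSpace E] [BorelSpace E]
    {μ : MeasureTheory.Measure E} [μ.IsAddHaarMeasure] {C : NNReal} {f : E → E} {s : Set E}
    (hf : LipschitzOnWith C f s) (hs : μ s = 0) : μ (f '' s) = 0 := by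
  set ν : MeasureTheory.Measure E := MeasureTheory.Measure.hausdorffMeasure (Module.finrank ℝ E)
  have h1 := MeasureTheory.Measure.absolutelyContinuous_isAddHaarMeasure μ ν
  have h2 := MeasureTheory.Measure.absolutelyContinuous_isAddHaarMeasure ν μ
  refine h1 (le_antisymm ((hf.hausdorffMeasure_image_le (Nat.cast_nonneg _)).trans ?_) zero_le)
  rw [show MeasureTheory.Measure.hausdorffMeasure (Module.finrank ℝ E) s = ν s from rfl, h2 hs,
    mul_zero]

namespace IsProperAffineAction

section Degree

open MeasureTheory
open scoped ENNReal

variable {E Γ : Type*} [NormedAddCommGroup E] [NormedSpace ℝ E] [FiniteDimensional ℝ E]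
  [MeasurableSpace E] [BorelSpace E] [Group Γ] [MulAction Γ E]
  {lin : Γ → E →ₗ[ℝ] E} {Ω : Set E}

theorem setLIntegral_det_mul_inv_orbitCount (h : IsProperAffineAction lin Ω)
    (hdet : ∀ γ, LinearMap.det (lin γ) = 1) (μ : Measure E) [μ.IsAddHaarMeasure] [Countable Γ]
    {K : Set E} (hK : IsCompact K) (hKΩ : K ⊆ Ω) (hcov : ∀ x ∈ Ω, ∃ γ : Γ, γ⁻¹ • x ∈ K)
    {w : E → E} {Λ : NNReal} (hw : LipschitzOnWith Λ w K)
    (hdiff : ∀ᵐ x ∂μ, x ∈ K → DifferentiableAt ℝ w x)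
    (hequi : ∀ γ : Γ, ∀ x ∈ Ω, w (γ • x) = lin γ (w x)) {t : ℝ}
    (hbij : BijOn (fun x => x + t • w x) Ω Ω) :
    ∫⁻ x in K, ENNReal.ofReal |(1 + t • fderiv ℝ w x).det| * (orbitCount Γ K x)⁻¹ ∂μ =
      ∫⁻ x in K, (orbitCount Γ K x)⁻¹ ∂μ := by
  set G : E → E := fun x => x + t • w x
  have hGequi : ∀ γ : Γ, ∀ x ∈ Ω, γ • G x = G (γ • x) := fun γ x hx =>
    h.smul_add_smul hequi γ hx t
  have hGLip : LipschitzOnWith (1 + ‖t‖₊ * Λ) G K :=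
    (LipschitzWith.id.lipschitzOnWith).add
      (((lipschitzWith_smul t).lipschitzOnWith (s := univ)).comp hw (mapsTo_univ _ _))
  have hGK : IsCompact (G '' K) := hK.image_of_continuousOn hGLip.continuousOn
  have hGKΩ : G '' K ⊆ Ω := (image_mono hKΩ).trans hbij.mapsTo.image_subset
  have hGcov : ∀ y ∈ Ω, ∃ γ : Γ, γ⁻¹ • y ∈ G '' K := by
    intro y hy
    obtain ⟨x, hx, rfl⟩ := hbij.surjOn hy
    obtain ⟨γ, hγ⟩ := hcov x hx
    exact ⟨γ, _, hγ, (hGequi _ _ hx).symm⟩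
  rw [← h.setLIntegral_inv_orbitCount hdet μ hGK hK hGKΩ hKΩ hGcov hcov]
  set D := K ∩ {x | DifferentiableAt ℝ w x}
  have hDm : MeasurableSet D := hK.measurableSet.inter (measurableSet_of_differentiableAt ℝ w)
  have hnull : μ (K \ D) = 0 := by
    refine measure_mono_null ?_ hdiff
    rintro x ⟨hx, hxD⟩ hx'
    exact hxD ⟨hx, hx' hx⟩
  have hDK : D =ᵐ[μ] K :=
    inter_subset_left.eventuallyLE.antisymm (ae_le_set.2 hnull)
  have hGDK : G '' D =ᵐ[μ] G '' K := by
    refine (image_mono inter_subset_left).eventuallyLE.antisymm (ae_le_set.2 ?_)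
    refine measure_mono_null (t := G '' (K \ D)) ?_ ?_
    · rintro _ ⟨⟨x, hx, rfl⟩, hxD⟩
      exact ⟨x, ⟨hx, fun hD => hxD ⟨x, hD, rfl⟩⟩, rfl⟩
    exact (hGLip.mono sdiff_subset).addHaar_image_eq_zero hnull
  rw [← setLIntegral_congr hDK, ← setLIntegral_congr hGDK,
    lintegral_image_eq_lintegral_abs_det_fderiv_mul μ hDm (f := G)
      (f' := fun x => 1 + t • fderiv ℝ w x)]
  · refine setLIntegral_congr_fun hDm fun x hx => ?_
    rw [orbitCount_image hbij.injOn hKΩ h hGequi (hKΩ hx.1)]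
  · intro x hx
    exact ((hasFDerivAt_id x).add (hx.2.hasFDerivAt.const_smul t)).hasFDerivWithinAt
  · exact hbij.injOn.mono (inter_subset_left.trans hKΩ)

/-- An equivariant locally Lipschitz map `x ↦ x + w x` on a cocompact domain with a unimodular
properly discontinuous affine action cannot be degenerate almost everywhere. -/
theorem exists_differentiableAt_det_ne_zero (h : IsProperAffineAction lin Ω)
    (hdet : ∀ γ, LinearMap.det (lin γ) = 1) (hΩ : IsOpen Ω) (hne : Ω.Nonempty)
    {K : Set E} (hK : IsCompact K) (hKΩ : K ⊆ Ω) (hcov : ∀ x ∈ Ω, ∃ γ : Γ, γ⁻¹ • x ∈ K)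
    {w : E → E} (hw : LocallyLipschitzOn Ω w)
    (hequi : ∀ γ : Γ, ∀ x ∈ Ω, w (γ • x) = lin γ (w x)) :
    ∃ x ∈ Ω, DifferentiableAt ℝ w x ∧ (1 + fderiv ℝ w x).det ≠ 0 := by
  by_contra! hzero
  have := h.countable hΩ hne
  let μ : Measure E := Measure.addHaar
  obtain ⟨δ, hδ, hδΩ⟩ := hK.exists_cthickening_subset_open hΩ hKΩ
  set K' := Metric.cthickening δ K
  have hK' : IsCompact K' := hK.cthickening
  have hKK' : Metric.thickening δ K ⊆ K' := Metric.thickening_subset_cthickening δ K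
  have hKnhds : ∀ x ∈ K, K' ∈ 𝓝 x := fun x hx => mem_of_superset
    (Metric.isOpen_thickening.mem_nhds (Metric.self_subset_thickening hδ K hx)) hKK'
  obtain ⟨Λ, hΛ⟩ := (hw.mono hδΩ).exists_lipschitzOnWith_of_compact hK'
  have hdiff : ∀ᵐ x ∂μ, x ∈ K → DifferentiableAt ℝ w x := by
    filter_upwards [hΛ.ae_differentiableWithinAt_of_mem (μ := μ)] with x hx hxK
    exact (hx (mem_of_mem_nhds (hKnhds x hxK))).differentiableAt (hKnhds x hxK)
  have hbound : ∀ x ∈ K, ‖fderiv ℝ w x‖ ≤ Λ := fun x hx =>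
    norm_fderiv_le_of_lipschitzOn ℝ (hKnhds x hx) hΛ
  obtain ⟨ε, hε, hbij⟩ := h.exists_bijOn_add_smul hΩ hK hKΩ hcov hw hequi
  have hcontdet : Continuous fun A : E →L[ℝ] E => A.det := ContinuousLinearMap.continuous_det
  obtain ⟨r, hr, hrdet⟩ : ∃ r > 0, ∀ A : E →L[ℝ] E, ‖A‖ < r → 0 < (1 + A).det := by
    have h1 : ∀ᶠ A : E →L[ℝ] E in 𝓝 0, 0 < (1 + A).det := by
      refine ((hcontdet.comp (continuous_const.add continuous_id)).tendsto 0).eventually_const_lt ?_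
      have h2 : ContinuousLinearMap.det (1 : E →L[ℝ] E) = 1 := LinearMap.det_id
      simp [h2]
    obtain ⟨r, hr, h2⟩ := Metric.eventually_nhds_iff.1 h1
    exact ⟨r, hr, fun A hA => h2 (by simpa using hA)⟩
  obtain ⟨m, c, t, ht, hc, hsum⟩ :=
    exists_sum_det_eq (E := E) (lt_min hε (show 0 < r / (Λ + 1) by positivity))
  set N := fun x : E => (orbitCount Γ K x)⁻¹
  have hNm : Measurable N := (h.measurable_orbitCount hK.measurableSet).inv
  have hN0 : ∀ x ∈ K, N x ≠ 0 := fun x hx =>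
    ENNReal.inv_ne_zero.2 (h.orbitCount_ne_top subset_rfl hK hKΩ (hKΩ hx))
  have hN1 : ∀ x ∈ K, N x ≤ 1 := by
    intro x hx
    refine ENNReal.inv_le_one.2 ?_
    refine le_trans ?_ (ENNReal.le_tsum (1 : Γ))
    simp [hx]
  set V := ∫⁻ x in K, N x ∂μ
  have hVtop : V ≠ ∞ := by
    refine ne_top_of_le_ne_top hK.measure_lt_top.ne (b := μ K) ?_
    calc V ≤ ∫⁻ x in K, 1 ∂μ := setLIntegral_mono measurable_const hN1
      _ = μ K := by simp
  have hV0 : V ≠ 0 := by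
    intro hV
    rw [lintegral_eq_zero_iff hNm] at hV
    have hμK : μ K = 0 := by
      have := (ae_restrict_iff' hK.measurableSet).1 hV
      refine measure_mono_null ?_ this
      intro x hx hx'
      exact hN0 x hx (hx' hx)
    refine hΩ.measure_ne_zero μ hne (measure_mono_null (t := ⋃ γ : Γ, (γ⁻¹ • ·) ⁻¹' K) ?_ ?_)
    · intro x hx
      exact mem_iUnion.2 (hcov x hx)
    · refine measure_iUnion_null fun γ => ?_
      rw [(h.measurePreserving_smul hdet μ γ⁻¹).measure_preimage
        hK.measurableSet.nullMeasurableSet, hμK]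
  have hmeas : ∀ s : ℝ, Measurable fun x => (1 + s • fderiv ℝ w x).det := fun s =>
    hcontdet.measurable.comp (((measurable_fderiv ℝ w).const_smul s).const_add 1)
  have hpos : ∀ i, ∀ x ∈ K, 0 < (1 + t i • fderiv ℝ w x).det := by
    intro i x hx
    have hti := (ht i).2.trans_le (min_le_right _ _)
    have h0 := (ht i).1
    refine hrdet _ ?_
    rw [norm_smul, Real.norm_of_nonneg h0.le]
    have h2 := (lt_div_iff₀ (by positivity)).1 hti
    nlinarith [hbound x hx]
  have hlint : ∀ i, ∫⁻ x in K, ENNReal.ofReal ((1 + t i • fderiv ℝ w x).det * (N x).toReal) ∂μ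
      = V := by
    intro i
    have hti : t i ∈ Ioo 0 ε := ⟨(ht i).1, (ht i).2.trans_le (min_le_left _ _)⟩
    have h1 := h.setLIntegral_det_mul_inv_orbitCount hdet μ hK hKΩ hcov
      (hΛ.mono (Metric.self_subset_cthickening K)) hdiff hequi (hbij _ hti)
    refine Eq.trans (setLIntegral_congr_fun hK.measurableSet fun x hx => ?_) h1
    have hNx : N x ≠ ∞ := ne_top_of_le_ne_top ENNReal.one_ne_top (hN1 x hx)
    simp only [ENNReal.ofReal_mul (hpos i x hx).le, ENNReal.ofReal_toReal hNx,
      abs_of_pos (hpos i x hx), N]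
  have hnonneg : ∀ i, 0 ≤ᵐ[μ.restrict K]
      fun x => (1 + t i • fderiv ℝ w x).det * (N x).toReal := by
    intro i
    filter_upwards [ae_restrict_mem hK.measurableSet] with x hx
    exact mul_nonneg (hpos i x hx).le ENNReal.toReal_nonneg
  have hmeas' : ∀ i, AEStronglyMeasurable
      (fun x => (1 + t i • fderiv ℝ w x).det * (N x).toReal) (μ.restrict K) := fun i =>
    ((hmeas (t i)).mul hNm.ennreal_toReal).aestronglyMeasurable
  have hint : ∀ i, Integrable (fun x => (1 + t i • fderiv ℝ w x).det * (N x).toReal)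
      (μ.restrict K) := by
    intro i
    refine ⟨hmeas' i, ?_⟩
    rw [hasFiniteIntegral_iff_ofReal (hnonneg i), hlint i]
    exact hVtop.lt_top
  have hval : ∀ i, ∫ x in K, (1 + t i • fderiv ℝ w x).det * (N x).toReal ∂μ = V.toReal := by
    intro i
    rw [integral_eq_lintegral_of_nonneg_ae (hnonneg i) (hmeas' i), hlint i]
  have hfinal : ∫ x in K, ∑ i, c i * ((1 + t i • fderiv ℝ w x).det * (N x).toReal) ∂μ
      = V.toReal := by
    rw [integral_finsetSum _ fun i _ => (hint i).const_mul (c i)]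
    simp_rw [integral_const_mul, hval]
    rw [← Finset.sum_mul, hc, one_mul]
  have hzero' : ∫ x in K, ∑ i, c i * ((1 + t i • fderiv ℝ w x).det * (N x).toReal) ∂μ = 0 := by
    refine integral_eq_zero_of_ae ?_
    filter_upwards [ae_restrict_mem hK.measurableSet, ae_restrict_of_ae hdiff] with x hx hdx
    simp_rw [← mul_assoc]
    rw [← Finset.sum_mul, ← hsum, hzero x (hKΩ hx) (hdx hx), zero_mul, Pi.zero_apply]
  exact ENNReal.toReal_ne_zero.2 ⟨hV0, hVtop⟩ (hfinal.symm.trans hzero')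

end Degree

end IsProperAffineAction

theorem LocallyLipschitzOn.comp {α β γ : Type*} [PseudoEMetricSpace α] [PseudoEMetricSpace β]
    [PseudoEMetricSpace γ] {f : β → γ} {g : α → β} {s : Set α} {t : Set β}
    (hf : LocallyLipschitzOn t f) (hg : LocallyLipschitzOn s g) (hst : MapsTo g s t) :
    LocallyLipschitzOn s (f ∘ g) := by
  intro x hx
  obtain ⟨Kg, a, ha, hgL⟩ := hg hx
  obtain ⟨Kf, b, hb, hfL⟩ := hf (hst hx)
  refine ⟨Kf * Kg, a ∩ g ⁻¹' b,
    inter_mem ha ((hg.continuousOn x hx).tendsto_nhdsWithin hst hb), ?_⟩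
  exact hfL.comp (hgL.mono inter_subset_left) fun y hy => hy.2

theorem LocallyLipschitzOn.prodMk {α β γ : Type*} [PseudoEMetricSpace α] [PseudoEMetricSpace β]
    [PseudoEMetricSpace γ] {f : α → β} {g : α → γ} {s : Set α}
    (hf : LocallyLipschitzOn s f) (hg : LocallyLipschitzOn s g) :
    LocallyLipschitzOn s fun x => (f x, g x) := by
  intro x hx
  obtain ⟨Kf, a, ha, hfL⟩ := hf hx
  obtain ⟨Kg, b, hb, hgL⟩ := hg hx
  exact ⟨max Kf Kg, a ∩ b, inter_mem ha hb,
    (hfL.mono inter_subset_left).prodMk (hgL.mono inter_subset_right)⟩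

section ExitTime

variable {E : Type*} [NormedAddCommGroup E] [NormedSpace ℝ E] {Ω : Set E}

theorem mem_asymptoticCone_of_forall_add_smul_mem {x v : E}
    (h : ∀ t : ℝ, 0 ≤ t → x + t • v ∈ Ω) : v ∈ asymptoticCone ℝ Ω := by
  have h1 := ((tendsto_id (α := ℝ) (x := atTop)).atTop_smul_const_tendsto_asymptoticNhds
    v).const_vadd_asymptoticNhds x
  refine h1.frequently (Eventually.frequently ?_)
  filter_upwards [eventually_ge_atTop 0] with t ht
  exact h t ht

theorem add_smul_mem_of_mem_asymptoticCone (hΩ : IsOpen Ω) (hconv : Convex ℝ Ω) {x v : E}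
    (hx : x ∈ Ω) (hv : v ∈ asymptoticCone ℝ Ω) {t : ℝ} (ht : 0 ≤ t) : x + t • v ∈ Ω := by
  have := hconv.smul_vadd_mem_of_mem_nhds_of_mem_asymptoticCone ht (hΩ.mem_nhds hx) hv
  rwa [vadd_eq_add, add_comm] at this

theorem add_mem_asymptoticCone (hΩ : IsOpen Ω) (hconv : Convex ℝ Ω) (hne : Ω.Nonempty) {v w : E}
    (hv : v ∈ asymptoticCone ℝ Ω) (hw : w ∈ asymptoticCone ℝ Ω) :
    v + w ∈ asymptoticCone ℝ Ω := by
  obtain ⟨x, hx⟩ := hne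
  refine mem_asymptoticCone_of_forall_add_smul_mem (x := x) fun t ht => ?_
  rw [smul_add, ← add_assoc]
  exact add_smul_mem_of_mem_asymptoticCone hΩ hconv
    (add_smul_mem_of_mem_asymptoticCone hΩ hconv hx hv ht) hw ht

theorem Convex.add_smul_mem_of_le (hconv : Convex ℝ Ω) {x v : E} (hx : x ∈ Ω) {s t : ℝ}
    (hs : 0 ≤ s) (hst : s ≤ t) (ht : x + t • v ∈ Ω) : x + s • v ∈ Ω := by
  rcases hs.eq_or_lt with rfl | hs
  · simpa using hx
  have ht0 : 0 < t := hs.trans_le hst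
  have := hconv.add_smul_mem hx ht (t := s / t)
    ⟨div_nonneg hs.le ht0.le, (div_le_one ht0).2 hst⟩
  rwa [smul_smul, div_mul_cancel₀ _ ht0.ne'] at this

/-- The time at which the ray `x + t • v` leaves `Ω`. -/
def exitTime (Ω : Set E) (x v : E) : ℝ := sSup {t : ℝ | 0 ≤ t ∧ x + t • v ∈ Ω}

theorem bddAbove_exitTime (hconv : Convex ℝ Ω) {x v : E} (hx : x ∈ Ω)
    (hv : v ∉ asymptoticCone ℝ Ω) : BddAbove {t : ℝ | 0 ≤ t ∧ x + t • v ∈ Ω} := by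
  by_contra hb
  refine hv (mem_asymptoticCone_of_forall_add_smul_mem (x := x) fun t ht => ?_)
  rw [not_bddAbove_iff] at hb
  obtain ⟨s, ⟨-, hs⟩, hts⟩ := hb t
  exact hconv.add_smul_mem_of_le hx ht hts.le hs

theorem le_exitTime (hconv : Convex ℝ Ω) {x v : E} (hx : x ∈ Ω) (hv : v ∉ asymptoticCone ℝ Ω)
    {t : ℝ} (ht : 0 ≤ t) (hxt : x + t • v ∈ Ω) : t ≤ exitTime Ω x v :=
  le_csSup (bddAbove_exitTime hconv hx hv) ⟨ht, hxt⟩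

theorem exitTime_le {x v : E} (hx : x ∈ Ω) {c : ℝ}
    (h : ∀ t : ℝ, 0 ≤ t → x + t • v ∈ Ω → t ≤ c) : exitTime Ω x v ≤ c :=
  csSup_le ⟨0, le_rfl, by simpa using hx⟩ fun t ht => h t ht.1 ht.2

theorem exitTime_nonneg (x v : E) : 0 ≤ exitTime Ω x v :=
  Real.sSup_nonneg fun _ ht => ht.1

theorem add_exitTime_smul_notMem (hΩ : IsOpen Ω) (hconv : Convex ℝ Ω) {x v : E} (hx : x ∈ Ω)
    (hv : v ∉ asymptoticCone ℝ Ω) : x + exitTime Ω x v • v ∉ Ω := by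
  intro hmem
  have h1 : ∀ᶠ t : ℝ in 𝓝 (exitTime Ω x v), x + t • v ∈ Ω :=
    (by fun_prop : Continuous fun t : ℝ => x + t • v).continuousAt.eventually_mem
      (hΩ.mem_nhds hmem)
  obtain ⟨t, ht, hlt⟩ := ((h1.filter_mono nhdsWithin_le_nhds).and
    (self_mem_nhdsWithin (s := Ioi (exitTime Ω x v)))).exists
  exact (le_exitTime hconv hx hv ((exitTime_nonneg x v).trans (le_of_lt hlt)) ht).not_gt hlt

theorem exitTime_pos (hΩ : IsOpen Ω) (hconv : Convex ℝ Ω) {x v : E} (hx : x ∈ Ω)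
    (hv : v ∉ asymptoticCone ℝ Ω) : 0 < exitTime Ω x v := by
  refine (exitTime_nonneg x v).lt_of_ne fun h => add_exitTime_smul_notMem hΩ hconv hx hv ?_
  rw [← h]
  simpa using hx

theorem add_smul_mem_of_lt_exitTime (hconv : Convex ℝ Ω) {x v : E} (hx : x ∈ Ω) {t : ℝ}
    (ht : 0 ≤ t) (hlt : t < exitTime Ω x v) : x + t • v ∈ Ω := by
  have hne : {t : ℝ | 0 ≤ t ∧ x + t • v ∈ Ω}.Nonempty := ⟨0, le_rfl, by simpa using hx⟩
  obtain ⟨s, ⟨-, hs⟩, hts⟩ := exists_lt_of_lt_csSup hne hlt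
  exact hconv.add_smul_mem_of_le hx ht hts.le hs

theorem add_exitTime_smul_mem_closure (hΩ : IsOpen Ω) (hconv : Convex ℝ Ω) {x v : E} (hx : x ∈ Ω)
    (hv : v ∉ asymptoticCone ℝ Ω) : x + exitTime Ω x v • v ∈ closure Ω := by
  have hpos := exitTime_pos hΩ hconv hx hv
  have h1 : ContinuousWithinAt (fun t : ℝ => x + t • v) (Ioo 0 (exitTime Ω x v))
      (exitTime Ω x v) :=
    (by fun_prop : Continuous fun t : ℝ => x + t • v).continuousWithinAt
  refine closure_mono ?_ (h1.mem_closure_image ?_)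
  · rintro _ ⟨t, ht, rfl⟩
    exact add_smul_mem_of_lt_exitTime hconv hx ht.1.le ht.2
  · rw [closure_Ioo hpos.ne]
    exact right_mem_Icc.2 hpos.le

theorem exists_add_smul_notMem_closure (hΩ : IsOpen Ω) (hconv : Convex ℝ Ω) {x v : E}
    (hx : x ∈ Ω) (hv : v ∉ asymptoticCone ℝ Ω) : ∃ t : ℝ, 0 < t ∧ x + t • v ∉ closure Ω := by
  have h0 := exitTime_nonneg (Ω := Ω) x v
  refine ⟨2 * (exitTime Ω x v + 1), by positivity, fun hcl => ?_⟩
  have h1 : x + (exitTime Ω x v + 1) • v ∈ Ω := by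
    refine interior_subset (hconv.openSegment_interior_closure_subset_interior
      (by rwa [hΩ.interior_eq]) hcl ?_)
    refine ⟨1 / 2, 1 / 2, by norm_num, by norm_num, by norm_num, ?_⟩
    module
  linarith [le_exitTime hconv hx hv (by positivity) h1]

theorem locallyLipschitzOn_exitTime (hΩ : IsOpen Ω) (hconv : Convex ℝ Ω) :
    LocallyLipschitzOn (Ω ×ˢ (asymptoticCone ℝ Ω)ᶜ) fun p : E × E => exitTime Ω p.1 p.2 := by
  rintro ⟨x₀, v₀⟩ ⟨hx₀, hv₀⟩
  obtain ⟨r, hr, hrΩ⟩ := Metric.isOpen_iff.1 hΩ x₀ hx₀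
  obtain ⟨T, hT, hTcl⟩ := exists_add_smul_notMem_closure hΩ hconv hx₀ hv₀
  have hmem : ∀ᶠ p : E × E in 𝓝 (x₀, v₀), p.1 ∈ Metric.ball x₀ (r / 2) ∧
      p.1 + T • p.2 ∉ closure Ω := by
    refine (continuous_fst.continuousAt.eventually_mem (Metric.ball_mem_nhds _ (by positivity))).and
      ?_
    exact (by fun_prop : Continuous fun p : E × E => p.1 + T • p.2).continuousAt.eventually_mem
      (isClosed_closure.isOpen_compl.mem_nhds hTcl)
  have hbound : ∀ {x v : E}, x ∈ Ω → x + T • v ∉ closure Ω → ∀ {t : ℝ}, 0 ≤ t → x + t • v ∈ Ω →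
      t ≤ T := by
    intro x v hx hxv t _ htx
    by_contra! hlt
    exact hxv (subset_closure (hconv.add_smul_mem_of_le hx hT.le hlt.le htx))
  refine ⟨_, _, inter_mem (mem_nhdsWithin_of_mem_nhds hmem) self_mem_nhdsWithin,
    LipschitzOnWith.of_le_add_mul' (T * (1 + T) / (r / 2)) ?_⟩
  rintro ⟨x, v⟩ ⟨⟨hxb, hxT⟩, hx, hv⟩ ⟨x', v'⟩ ⟨-, hx', hv'⟩
  dsimp only at hxb hxT hx hv hx' hv' ⊢
  set d := dist (x, v) (x', v')
  refine exitTime_le hx fun t ht htx => ?_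
  have htT := hbound hx hxT ht htx
  rcases (show 0 ≤ d from dist_nonneg).eq_or_lt with hd | hd
  · obtain ⟨rfl, rfl⟩ := Prod.mk.inj (dist_eq_zero.1 hd.symm)
    have := le_exitTime hconv hx hv ht htx
    have hd' : d = 0 := hd.symm
    rw [hd']
    simpa using this
  set s := (1 + T) * d / (r / 2) with hs
  have hs0 : 0 < s := by positivity
  have hgoal : T * (1 + T) / (r / 2) * d = T * s := by rw [hs]; ring
  rw [hgoal]
  have h0 := exitTime_nonneg (Ω := Ω) x' v'
  rcases le_or_gt 1 s with h1 | h1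
  · nlinarith
  have hsr : s * (r / 2) = (1 + T) * d := by rw [hs]; field_simp
  have hx1 : ‖x' - x‖ ≤ d := by
    rw [← dist_eq_norm, dist_comm]
    exact le_max_left _ _
  have hv1 : ‖v' - v‖ ≤ d := by
    rw [← dist_eq_norm, dist_comm]
    exact le_max_right _ _
  have hq : x + s⁻¹ • (x' - x + ((1 - s) * t) • (v' - v)) ∈ Ω := by
    refine hrΩ ?_
    have h2 : ‖x' - x + ((1 - s) * t) • (v' - v)‖ ≤ s * (r / 2) := by
      refine (norm_add_le _ _).trans ?_
      rw [norm_smul, Real.norm_of_nonneg (mul_nonneg (by linarith) ht), hsr]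
      have h3 : (1 - s) * t ≤ T := by nlinarith
      have h4 : (1 - s) * t * ‖v' - v‖ ≤ T * d :=
        mul_le_mul h3 hv1 (norm_nonneg _) hT.le
      linarith
    have h5 : ‖s⁻¹ • (x' - x + ((1 - s) * t) • (v' - v))‖ ≤ r / 2 := by
      rw [norm_smul, norm_inv, Real.norm_of_nonneg hs0.le, inv_mul_le_iff₀ hs0]
      exact h2
    rw [Metric.mem_ball, dist_eq_norm] at hxb ⊢
    rw [add_sub_right_comm]
    exact (norm_add_le _ _).trans_lt (by linarith)
  have h6 : x' + ((1 - s) * t) • v' ∈ Ω := by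
    have h7 := hconv htx hq (by linarith : 0 ≤ 1 - s) hs0.le (by ring)
    convert h7 using 1
    rw [smul_add s, smul_smul s, mul_inv_cancel₀ hs0.ne']
    module
  have h8 := le_exitTime hconv hx' hv' (mul_nonneg (by linarith) ht) h6
  nlinarith

end ExitTime

namespace IsProperAffineAction

section EquivariantField

variable {E Γ : Type*} [NormedAddCommGroup E] [NormedSpace ℝ E] [FiniteDimensional ℝ E]
  [Group Γ] [MulAction Γ E] {lin : Γ → E →ₗ[ℝ] E} {Ω : Set E}

theorem exists_locallyLipschitzOn_equivariant (h : IsProperAffineAction lin Ω) (hΩ : IsOpen Ω)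
    {K : Set E} (hK : IsCompact K) (hKΩ : K ⊆ Ω) (hcov : ∀ x ∈ Ω, ∃ γ : Γ, γ⁻¹ • x ∈ K)
    {S : Set E} (hSlin : ∀ γ, ∀ v ∈ S, lin γ v ∈ S) (hSadd : ∀ v ∈ S, ∀ w ∈ S, v + w ∈ S)
    (hSsmul : ∀ a : ℝ, 0 < a → ∀ v ∈ S, a • v ∈ S) (hS : S.Nonempty) :
    ∃ u : E → E, LocallyLipschitzOn Ω u ∧ (∀ γ : Γ, ∀ x ∈ Ω, u (γ • x) = lin γ (u x)) ∧
      ∀ x ∈ Ω, u x ∈ S := by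
  obtain ⟨c, hc⟩ := hS
  obtain ⟨δ, hδ, hδΩ⟩ := hK.exists_cthickening_subset_open hΩ hKΩ
  have hK' : IsCompact (Metric.cthickening δ K) := hK.cthickening
  let φ : E → ℝ := fun x => max (δ - Metric.infDist x K) 0
  have hφ0 : ∀ x, 0 ≤ φ x := fun x => le_max_right _ _
  have hφK : ∀ x ∈ K, 0 < φ x := fun x hx => by
    simpa [φ, Metric.infDist_zero_of_mem hx] using hδ
  have hφLip : LocallyLipschitz φ := by
    refine LocallyLipschitz.max_const ?_ 0
    have := (Metric.lipschitz_infDist_pt K).locallyLipschitz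
    exact (LocallyLipschitz.const δ).sub this
  have hsum : ∀ x ∈ Ω, ∀ γ ∉ {γ : Γ | γ⁻¹ • x ∈ Metric.cthickening δ K},
      φ (γ⁻¹ • x) = 0 := by
    intro x hx γ hγ
    obtain ⟨η, hη⟩ := hcov x hx
    have hd : δ ≤ Metric.infDist (γ⁻¹ • x) K := by
      by_contra! hlt
      exact hγ (Metric.thickening_subset_cthickening δ K
        ((Metric.mem_thickening_iff_infDist_lt ⟨_, hη⟩).2 hlt))
    exact max_eq_right (sub_nonpos.2 hd)
  let u : E → E := fun x => ∑ᶠ γ : Γ, φ (γ⁻¹ • x) • lin γ c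
  have hfin : ∀ x ∈ Ω, {γ : Γ | γ⁻¹ • x ∈ Metric.cthickening δ K}.Finite := fun x hx =>
    h.finite_inv_smul_mem hK' hδΩ hx
  refine ⟨u, fun x hx => ?_, fun η x hx => ?_, fun x hx => ?_⟩
  · obtain ⟨r, hr, hrΩ⟩ := Metric.nhds_basis_closedBall.mem_iff.1 (hΩ.mem_nhds hx)
    have hF := h.finite _ _ hδΩ hrΩ hK' (isCompact_closedBall x r)
    set F := hF.toFinset
    have hu : EqOn u (fun y => ∑ γ ∈ F, φ (γ⁻¹ • y) • lin γ c) (Metric.closedBall x r) := by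
      intro y hy
      refine finsum_eq_sum_of_support_subset _ fun γ hγ => ?_
      by_contra hγF
      refine (smul_ne_zero_iff.1 hγ).1 (hsum y (hrΩ hy) γ fun hmem => hγF ?_)
      simp only [F, Finite.coe_toFinset]
      exact ⟨_, hmem, by simpa using hy⟩
    have hLip : LocallyLipschitz fun y => ∑ γ ∈ F, φ (γ⁻¹ • y) • lin γ c := by
      rw [← Finset.sum_fn]
      refine Finset.sum_induction
        (fun γ => fun y => φ (γ⁻¹ • y) • lin γ c) LocallyLipschitz (fun _ _ => .add)
        (.const 0) fun γ _ => ?_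
      have h1 : LocallyLipschitz fun y : E => γ⁻¹ • y := by
        rw [show (fun y : E => γ⁻¹ • y) = fun y => γ⁻¹ • 0 + lin γ⁻¹ y from
          funext (h.smul_eq γ⁻¹)]
        exact (LocallyLipschitz.const _).add
          (LinearMap.toContinuousLinearMap (lin γ⁻¹)).lipschitz.locallyLipschitz
      have h2 : LocallyLipschitz fun a : ℝ => a • lin γ c :=
        (ContinuousLinearMap.toSpanSingleton ℝ (lin γ c)).lipschitz.locallyLipschitz
      exact h2.comp (hφLip.comp h1)
    obtain ⟨k, t, ht, hk⟩ := hLip x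
    refine ⟨k, t ∩ Metric.closedBall x r, mem_nhdsWithin_of_mem_nhds
      (inter_mem ht (Metric.closedBall_mem_nhds x hr)), ?_⟩
    intro y hy z hz
    rw [hu hy.2, hu hz.2]
    exact hk hy.1 hz.1
  · have hsupp : (Function.support fun γ : Γ => φ (γ⁻¹ • x) • lin γ c).Finite :=
      (hfin x hx).subset fun γ hγ => by_contra fun hmem =>
        (smul_ne_zero_iff.1 hγ).1 (hsum x hx γ hmem)
    change ∑ᶠ γ : Γ, φ (γ⁻¹ • η • x) • lin γ c =
      (lin η).toAddMonoidHom (∑ᶠ γ : Γ, φ (γ⁻¹ • x) • lin γ c)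
    rw [AddMonoidHom.map_finsum _ hsupp, ← finsum_comp_equiv (Equiv.mulLeft η)
      (f := fun γ => φ (γ⁻¹ • η • x) • lin γ c)]
    refine finsum_congr fun γ => ?_
    simp [mul_smul, h.lin_mul]
  · obtain ⟨η, hη⟩ := hcov x hx
    have hsub : (Function.support fun γ : Γ => φ (γ⁻¹ • x)) ⊆
        {γ : Γ | γ⁻¹ • x ∈ Metric.cthickening δ K} := fun γ hγ => by
      by_contra hmem
      exact hγ (hsum x hx γ hmem)
    have hsupp := (hfin x hx).subset hsub
    rw [show u x = ∑ γ ∈ hsupp.toFinset, φ (γ⁻¹ • x) • lin γ c from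
      finsum_eq_sum_of_support_subset _ fun γ hγ => by
        simpa using (smul_ne_zero_iff.1 hγ).1]
    refine Finset.sum_induction_nonempty _ (· ∈ S) (fun v w hv hw => hSadd v hv w hw)
      ⟨η, by simpa using (hφK _ hη).ne'⟩ fun γ hγ => ?_
    refine hSsmul _ ((hφ0 _).lt_of_ne' (by simpa using hγ)) _ (hSlin γ c hc)

end EquivariantField

section Convex

variable {E Γ : Type*} [NormedAddCommGroup E] [NormedSpace ℝ E] [Group Γ] [MulAction Γ E]
  {lin : Γ → E →ₗ[ℝ] E} {Ω : Set E}

theorem smul_add_smul_lin_mem_iff (h : IsProperAffineAction lin Ω) (γ : Γ) (x v : E) (t : ℝ) :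
    γ • x + t • lin γ v ∈ Ω ↔ x + t • v ∈ Ω := by
  rw [← map_smul, ← h.smul_add, h.smul_mem_iff]

theorem lin_mem_asymptoticCone (h : IsProperAffineAction lin Ω) (hΩ : IsOpen Ω)
    (hconv : Convex ℝ Ω) (hne : Ω.Nonempty) (γ : Γ) {v : E} (hv : v ∈ asymptoticCone ℝ Ω) :
    lin γ v ∈ asymptoticCone ℝ Ω := by
  obtain ⟨x, hx⟩ := hne
  refine mem_asymptoticCone_of_forall_add_smul_mem (x := γ • x) fun t ht => ?_
  rw [h.smul_add_smul_lin_mem_iff]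
  exact add_smul_mem_of_mem_asymptoticCone hΩ hconv hx hv ht

theorem exitTime_smul_lin (h : IsProperAffineAction lin Ω) (γ : Γ) (x v : E) :
    exitTime Ω (γ • x) (lin γ v) = exitTime Ω x v := by
  simp_rw [exitTime, h.smul_add_smul_lin_mem_iff]

variable [FiniteDimensional ℝ E]

/-- If every ray `x + t • u x` of an equivariant field `u` leaves `Ω`, pushing points to the
boundary along these rays would be a degenerate equivariant map. -/
theorem not_forall_notMem_asymptoticCone (h : IsProperAffineAction lin Ω)
    (hdet : ∀ γ, LinearMap.det (lin γ) = 1) (hΩ : IsOpen Ω) (hconv : Convex ℝ Ω)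
    (hne : Ω.Nonempty) {K : Set E} (hK : IsCompact K) (hKΩ : K ⊆ Ω)
    (hcov : ∀ x ∈ Ω, ∃ γ : Γ, γ⁻¹ • x ∈ K) {u : E → E} (hu : LocallyLipschitzOn Ω u)
    (hequi : ∀ γ : Γ, ∀ x ∈ Ω, u (γ • x) = lin γ (u x)) :
    ¬ ∀ x ∈ Ω, u x ∉ asymptoticCone ℝ Ω := by
  intro hux
  borelize E
  let w : E → E := fun x => exitTime Ω x (u x) • u x
  have hw : LocallyLipschitzOn Ω w := by
    have h1 : LocallyLipschitzOn Ω fun x => exitTime Ω x (u x) :=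
      LocallyLipschitzOn.comp (g := fun x => (x, u x)) (locallyLipschitzOn_exitTime hΩ hconv)
        (LocallyLipschitzOn.prodMk (f := fun x => x) LocallyLipschitz.id.locallyLipschitzOn hu)
        fun x hx => ⟨hx, hux x hx⟩
    have h2 : LocallyLipschitz fun p : ℝ × E => p.1 • p.2 :=
      ContDiff.locallyLipschitz (𝕂 := ℝ) (contDiff_fst.smul contDiff_snd)
    exact LocallyLipschitzOn.comp (g := fun x => (exitTime Ω x (u x), u x))
      (h2.locallyLipschitzOn (s := univ)) (h1.prodMk hu) (mapsTo_univ _ _)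
  have hwequi : ∀ γ : Γ, ∀ x ∈ Ω, w (γ • x) = lin γ (w x) := by
    intro γ x hx
    simp only [w, hequi γ x hx, h.exitTime_smul_lin, map_smul]
  obtain ⟨x, hx, hdiff, hdetx⟩ :=
    h.exists_differentiableAt_det_ne_zero hdet hΩ hne hK hKΩ hcov hw hwequi
  obtain ⟨f, hf⟩ := geometric_hahn_banach_open_point hconv hΩ
    (add_exitTime_smul_notMem hΩ hconv hx (hux x hx))
  have hfcl : ∀ y ∈ closure Ω, f y ≤ f (x + w x) := fun y hy =>
    closure_minimal (fun z hz => (hf z hz).le) (isClosed_le f.continuous continuous_const) hy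
  have hmax : IsLocalMax (fun y => f (y + w y)) x := by
    filter_upwards [hΩ.mem_nhds hx] with y hy
    exact hfcl _ (add_exitTime_smul_mem_closure hΩ hconv hy (hux y hy))
  have hderiv : HasFDerivAt (fun y => f (y + w y)) (f.comp (1 + fderiv ℝ w x)) x :=
    f.hasFDerivAt.comp x ((hasFDerivAt_id x).add hdiff.hasFDerivAt)
  have hzero := hmax.hasFDerivAt_eq_zero hderiv
  obtain ⟨y, hy⟩ := (LinearMap.equivOfDetNeZero _ hdetx).surjective (w x)
  have h3 : f (w x) = 0 := by
    rw [← hy]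
    exact DFunLike.congr_fun hzero y
  have h4 := hf x hx
  change f x < f (x + w x) at h4
  rw [map_add, h3, add_zero] at h4
  exact h4.false

theorem neg_mem_asymptoticCone (h : IsProperAffineAction lin Ω)
    (hdet : ∀ γ, LinearMap.det (lin γ) = 1) (hΩ : IsOpen Ω) (hconv : Convex ℝ Ω)
    (hne : Ω.Nonempty) {K : Set E} (hK : IsCompact K) (hKΩ : K ⊆ Ω)
    (hcov : ∀ x ∈ Ω, ∃ γ : Γ, γ⁻¹ • x ∈ K) {c : E} (hc : c ∈ asymptoticCone ℝ Ω) :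
    -c ∈ asymptoticCone ℝ Ω := by
  by_contra hneg
  have hlin : ∀ (γ : Γ) {v : E}, v ∈ asymptoticCone ℝ Ω → lin γ v ∈ asymptoticCone ℝ Ω :=
    fun γ _ => h.lin_mem_asymptoticCone hΩ hconv hne γ
  obtain ⟨u, hu, hequi, huS⟩ := h.exists_locallyLipschitzOn_equivariant hΩ hK hKΩ hcov
    (S := {v | -v ∈ asymptoticCone ℝ Ω ∧ v ∉ asymptoticCone ℝ Ω})
    (fun γ v hv => ⟨by simpa using hlin γ hv.1,
      fun hmem => hv.2 (by simpa [h.lin_inv_apply] using hlin γ⁻¹ hmem)⟩)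
    (fun v hv w hw => ⟨by
        rw [neg_add]
        exact add_mem_asymptoticCone hΩ hconv hne hv.1 hw.1,
      fun hmem => hv.2 (by simpa using add_mem_asymptoticCone hΩ hconv hne hmem hw.1)⟩)
    (fun a ha v hv => ⟨by
        rw [← smul_neg]
        exact smul_mem_asymptoticCone ha.le hv.1,
      fun hmem => hv.2 ((smul_mem_asymptoticCone_iff ha).1 hmem)⟩)
    ⟨-c, by simpa using hc, hneg⟩
  exact h.not_forall_notMem_asymptoticCone hdet hΩ hconv hne hK hKΩ hcov hu hequi
    fun x hx => (huS x hx).2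

/-- A cocompact convex open domain whose recession cone is a linear subspace is the whole space. -/
theorem eq_univ_of_neg_mem_asymptoticCone (h : IsProperAffineAction lin Ω) (hΩ : IsOpen Ω)
    (hconv : Convex ℝ Ω) (hne : Ω.Nonempty) {K : Set E} (hK : IsCompact K) (hKΩ : K ⊆ Ω)
    (hcov : ∀ x ∈ Ω, ∃ γ : Γ, γ⁻¹ • x ∈ K)
    (hneg : ∀ c ∈ asymptoticCone ℝ Ω, -c ∈ asymptoticCone ℝ Ω) : Ω = univ := by
  let L : Submodule ℝ E :=
    { carrier := asymptoticCone ℝ Ω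
      add_mem' := add_mem_asymptoticCone hΩ hconv hne
      zero_mem' := zero_mem_asymptoticCone.2 hne
      smul_mem' := by
        intro a v hv
        rcases le_total 0 a with ha | ha
        · exact smul_mem_asymptoticCone ha hv
        · rw [← neg_smul_neg]
          exact smul_mem_asymptoticCone (neg_nonneg.2 ha) (hneg v hv) }
  obtain ⟨M, hM⟩ := L.exists_isCompl
  have hbdd : Bornology.IsBounded (Ω ∩ M) := by
    rw [isBounded_iff_asymptoticCone_subset_singleton]
    intro v hv
    have hvL : v ∈ L := asymptoticCone_mono inter_subset_left hv
    have hvM : v ∈ (M : Set E) := by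
      have := asymptoticCone_mono inter_subset_right hv
      rwa [asymptoticCone_submodule, M.closed_of_finiteDimensional.closure_eq] at this
    exact Submodule.disjoint_def.1 hM.disjoint v hvL hvM
  obtain ⟨R, hR0, hR⟩ := hbdd.exists_pos_norm_le
  have hdecomp : ∀ y : E, ∃ l m, l ∈ L ∧ m ∈ M ∧ l + m = y := fun y =>
    Submodule.codisjoint_iff_exists_add_eq.1 hM.codisjoint y
  choose q p hq hp hqp using hdecomp
  have hpR : ∀ y ∈ Ω, ‖p y‖ ≤ R := by
    intro y hy
    refine hR _ ⟨?_, hp y⟩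
    have := add_smul_mem_of_mem_asymptoticCone hΩ hconv hy (hneg _ (hq y)) zero_le_one
    rwa [one_smul, ← sub_eq_add_neg, sub_eq_of_eq_add' (hqp y).symm] at this
  obtain ⟨δ, hδ, hδΩ⟩ := hK.exists_cthickening_subset_open hΩ hKΩ
  set r := δ / (2 * R)
  have hr : 0 < r := by positivity
  have hreflK : ∀ x ∈ K, ∀ y ∈ Ω, x + (-r) • (y - x) ∈ Ω := by
    intro x hx y hy
    have h1 : x + (-r) • (p y - p x) ∈ Ω := by
      refine hδΩ (Metric.mem_cthickening_of_dist_le _ x δ K hx ?_)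
      rw [dist_self_add_left, norm_smul, norm_neg, Real.norm_of_nonneg hr.le]
      calc r * ‖p y - p x‖ ≤ r * (R + R) := by
            gcongr
            exact (norm_sub_le _ _).trans (add_le_add (hpR y hy) (hpR x (hKΩ hx)))
        _ = δ := by simp only [r]; field_simp; ring
    have h2 : (-r) • (q y - q x) ∈ L := L.smul_mem _ (L.sub_mem (hq y) (hq x))
    have h3 := add_smul_mem_of_mem_asymptoticCone hΩ hconv h1 h2 zero_le_one
    convert h3 using 1
    nth_rewrite 1 [← hqp y]
    nth_rewrite 2 [← hqp x]
    module
  have hrefl : ∀ x ∈ Ω, ∀ y ∈ Ω, x + (-r) • (y - x) ∈ Ω := by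
    intro x hx y hy
    obtain ⟨γ, hγ⟩ := hcov x hx
    have h1 := hreflK _ hγ _ (h.smul_mem γ⁻¹ y hy)
    have h2 : γ⁻¹ • y - γ⁻¹ • x = lin γ⁻¹ (y - x) := by
      rw [sub_eq_iff_eq_add', ← h.smul_add, add_sub_cancel]
    rwa [h2, h.smul_add_smul_lin_mem_iff] at h1
  have hclosed : IsClosed Ω := by
    refine isClosed_of_closure_subset fun ξ hξ => ?_
    obtain ⟨y, hy⟩ := hne
    have h1 : ξ + (-r) • (y - ξ) ∈ closure Ω :=
      map_mem_closure (f := fun x => x + (-r) • (y - x)) (by fun_prop) hξ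
        fun x hx => hrefl x hx y hy
    refine interior_subset (hconv.openSegment_interior_closure_subset_interior
      (by rwa [hΩ.interior_eq]) h1 ?_)
    have hr1 : 1 + r ≠ 0 := by positivity
    refine ⟨r / (1 + r), 1 / (1 + r), by positivity, by positivity, by field_simp; ring, ?_⟩
    have : ξ = (r / (1 + r)) • y + (1 / (1 + r)) • ((1 + r) • ξ - r • y) := by
      rw [smul_sub, smul_smul, smul_smul, one_div_mul_cancel hr1, one_smul, one_div_mul_eq_div]
      abel
    nth_rewrite 3 [this]
    module
  exact IsClopen.eq_univ ⟨hclosed, hΩ⟩ hne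

theorem eq_univ (h : IsProperAffineAction lin Ω)
    (hdet : ∀ γ, LinearMap.det (lin γ) = 1) (hΩ : IsOpen Ω) (hconv : Convex ℝ Ω)
    (hne : Ω.Nonempty) {K : Set E} (hK : IsCompact K) (hKΩ : K ⊆ Ω)
    (hcov : ∀ x ∈ Ω, ∃ γ : Γ, γ⁻¹ • x ∈ K) : Ω = univ :=
  h.eq_univ_of_neg_mem_asymptoticCone hΩ hconv hne hK hKΩ hcov fun _ hc =>
    h.neg_mem_asymptoticCone hdet hΩ hconv hne hK hKΩ hcov hc

end Convex

end IsProperAffineAction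

section AffineForm

variable {n : ℕ}

theorem affAct_one (x : Fin n → ℝ) : affAct n 1 x = x := by
  ext i
  simp [affAct, Matrix.one_apply, (Fin.castSucc_lt_last i).ne]

theorem affAct_mul {g g' : GL (Fin (n + 1)) ℝ} (hg' : IsAffineForm n g') (x : Fin n → ℝ) :
    affAct n (g * g') x = affAct n g (affAct n g' x) := by
  ext i
  simp only [affAct, Units.val_mul, Matrix.mul_apply, Fin.sum_univ_castSucc, hg'.1, hg'.2,
    mul_zero, add_zero, mul_one, mul_add, Finset.sum_add_distrib, Finset.mul_sum, Finset.sum_mul]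
  rw [Finset.sum_comm, add_assoc]
  simp only [mul_assoc]

/-- The linear part of an affine transformation in matrix form. -/
def affLin (g : GL (Fin (n + 1)) ℝ) : (Fin n → ℝ) →ₗ[ℝ] (Fin n → ℝ) :=
  Matrix.toLin' (Matrix.of fun i j : Fin n => g.val i.castSucc j.castSucc)

theorem affAct_add (g : GL (Fin (n + 1)) ℝ) (x v : Fin n → ℝ) :
    affAct n g (x + v) = affAct n g x + affLin g v := by
  ext i
  simp only [affAct, affLin, Matrix.toLin'_apply, Pi.add_apply, Matrix.mulVec, dotProduct,
    Matrix.of_apply, mul_add, Finset.sum_add_distrib]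
  ring

/-- A group of affine transformations in matrix form acts on `ℝⁿ`. -/
abbrev affMulAction (Γ : Subgroup (GL (Fin (n + 1)) ℝ)) (hΓ : ∀ g ∈ Γ, IsAffineForm n g) :
    MulAction Γ (Fin n → ℝ) where
  smul g x := affAct n g x
  one_smul := affAct_one
  mul_smul _ g' := affAct_mul (hΓ g' g'.2)

end AffineForm

/-- A convex affine domain Ω ⊊ ℝⁿ with nonempty limit set Λ_{Aut⁰(Ω)}
cannot cover a compact affine manifold with parallel volume. -/
theorem markus_conjecture_convex_limitSet (n : ℕ) (hn : 1 ≤ n) (Ω : Set (Fin n → ℝ))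
    (hdom : IsConvexDomain n Ω) (hproper : Ω ≠ Set.univ)
    (hlim : (limitSet n Ω (AutIdComp n Ω)).Nonempty) :
    ¬ ∃ Γ : Subgroup (GL (Fin (n + 1)) ℝ),
        (Γ : Set (GL (Fin (n + 1)) ℝ)) ⊆ AutSet n Ω ∧
        ActsFreely n Ω (Γ : Set (GL (Fin (n + 1)) ℝ)) ∧
        ActsProperlyDiscontinuously n Ω (Γ : Set (GL (Fin (n + 1)) ℝ)) ∧
        ActsCocompactly n Ω (Γ : Set (GL (Fin (n + 1)) ℝ)) ∧
        (∀ γ ∈ Γ, LinearPartDetOne n γ) := by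
  rintro ⟨Γ, hΓ, -, hpd, ⟨K, hK, hKΩ, hcov⟩, hdet⟩
  obtain ⟨hne, hΩ, hconv⟩ := hdom
  let _ := affMulAction Γ fun g hg => (hΓ hg).1
  have h : IsProperAffineAction (fun γ : Γ => affLin (γ : GL (Fin (n + 1)) ℝ)) Ω :=
    { smul_add := fun γ => affAct_add γ.1
      smul_mem := fun γ x hx => (hΓ γ.2).2.subset (mem_image_of_mem _ hx)
      finite := fun K L hKΩ hLΩ hK hL => by
        refine ((hpd K L hKΩ hLΩ hK hL).preimage Subtype.val_injective.injOn).subset ?_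
        rintro γ ⟨x, hx, hγx⟩
        exact ⟨γ.2, _, mem_image_of_mem _ hx, hγx⟩ }
  refine hproper (h.eq_univ (fun γ => ?_) hΩ hconv hne hK hKΩ fun x hx => ?_)
  · rw [affLin, LinearMap.det_toLin']
    exact hdet γ γ.2
  · rw [← hcov] at hx
    obtain ⟨γ, hγ, y, hy, rfl⟩ := mem_iUnion₂.1 hx
    refine ⟨⟨γ, hγ⟩, ?_⟩
    rwa [show affAct n γ y = (⟨γ, hγ⟩ : Γ) • y from rfl, inv_smul_smul]
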